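/- Let w be an A₂ weight on ℝ^d. Then for every dyadic cube I ∈ 𝒟 and every α ∈ Γ_d, (1/|E_{α,I}|) ∑_{J⊆I} ∑_{β: E_{β,J} ⊆ E_{α,I}} |ŵ^{1/2}(J,β) · ŵ^{-1/2}(J,β)| ≤ ( ⟨w⟩_{E_{α,I}} ⟨w^{-1}⟩_{E_{α,I}} )^{1/2} ≤ C_d · [w]^{1/2}_{A₂}, where ŵ^{±1/2}(J,β) = ⟨w^{±1/2}, h_J^β⟩_{L²} and C_d depends only on the dimension d. -/

import Mathlib

open MeasureTheory

noncomputable section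

/-- A dyadic cube in `ℝ^d`: the cube `∏ᵢ [mᵢ 2^k, (mᵢ+1) 2^k)`. -/
structure DyadicCube (d : ℕ) where
  k : ℤ
  m : Fin d → ℤ
deriving DecidableEq

namespace DyadicCube

/-- The underlying set of a dyadic cube. -/
def toSet {d : ℕ} (I : DyadicCube d) : Set (Fin d → ℝ) :=
  {x | ∀ i, (I.m i : ℝ) * (2 : ℝ) ^ I.k ≤ x i ∧ x i < ((I.m i : ℝ) + 1) * (2 : ℝ) ^ I.k}

/-- `J` is a dyadic child of `I`. -/
def IsChild {d : ℕ} (J I : DyadicCube d) : Prop :=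
  J.k + 1 = I.k ∧ J.toSet ⊆ I.toSet

end DyadicCube

/-- The index set `Γ_d = {0,1}^d \ {(1,…,1)}`. -/
def Gamma (d : ℕ) : Type := {v : Fin d → Bool // v ≠ fun _ => true}

instance {d : ℕ} : DecidableEq (Gamma d) := Subtype.instDecidableEq

/-- The average `⟨f⟩_E` of `f` over a set `E`. -/
def avg {d : ℕ} (E : Set (Fin d → ℝ)) (f : (Fin d → ℝ) → ℝ) : ℝ :=
  (∫ x in E, f x) / (volume E).toReal

/-- An axis-parallel cube with corner `c` and side length `r`. -/
def Cube {d : ℕ} (c : Fin d → ℝ) (r : ℝ) : Set (Fin d → ℝ) :=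
  {x | ∀ i, c i ≤ x i ∧ x i < c i + r}

/-- `A` is an upper bound for the `A₂` characteristic of `w`:
`⟨w⟩_I ⟨w⁻¹⟩_I ≤ A` for every cube `I`. -/
def IsA2Bound {d : ℕ} (w : (Fin d → ℝ) → ℝ) (A : ℝ) : Prop :=
  ∀ (c : Fin d → ℝ) (r : ℝ), 0 < r →
    avg (Cube c r) w * avg (Cube c r) (fun x => (w x)⁻¹) ≤ A

/-- A weight: a positive, measurable, locally integrable function (with locally
integrable reciprocal). -/
def IsWeight {d : ℕ} (w : (Fin d → ℝ) → ℝ) : Prop :=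
  (∀ x, 0 < w x) ∧ Measurable w ∧ LocallyIntegrable w volume ∧
    LocallyIntegrable (fun x => (w x)⁻¹) volume

/-- The `L¹`-normalized indicator `h¹_E = 1_E / |E|`. -/
def h1 {d : ℕ} (E : Set (Fin d → ℝ)) : (Fin d → ℝ) → ℝ :=
  fun x => ((volume E).toReal)⁻¹ * E.indicator (fun _ => (1 : ℝ)) x

/-- Wilson's system of pairs of sets `(E¹_{α,I}, E²_{α,I})` indexed by dyadic cubes
`I` and `α ∈ Γ_d`. -/
structure WilsonSystem (d : ℕ) where
  E1 : DyadicCube d → Gamma d → Set (Fin d → ℝ)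
  E2 : DyadicCube d → Gamma d → Set (Fin d → ℝ)
  childUnion1 : ∀ I α, ∃ S : Finset (DyadicCube d), S.Nonempty ∧
    (∀ J ∈ S, J.IsChild I) ∧ E1 I α = ⋃ J ∈ S, J.toSet
  childUnion2 : ∀ I α, ∃ S : Finset (DyadicCube d), S.Nonempty ∧
    (∀ J ∈ S, J.IsChild I) ∧ E2 I α = ⋃ J ∈ S, J.toSet
  measEq : ∀ I α, volume (E1 I α) = volume (E2 I α)
  disj : ∀ I α, Disjoint (E1 I α) (E2 I α)
  nestedOrDisjoint : ∀ I α J β, (I, α) ≠ (J, β) →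
    (E1 I α ∪ E2 I α) ⊆ E1 J β ∨ (E1 I α ∪ E2 I α) ⊆ E2 J β ∨
    (E1 J β ∪ E2 J β) ⊆ E1 I α ∨ (E1 J β ∪ E2 J β) ⊆ E2 I α ∨
    Disjoint (E1 I α ∪ E2 I α) (E1 J β ∪ E2 J β)

namespace WilsonSystem

variable {d : ℕ}

/-- `E_{α,I} = E¹_{α,I} ∪ E²_{α,I}`. -/
def E (W : WilsonSystem d) (I : DyadicCube d) (α : Gamma d) : Set (Fin d → ℝ) :=
  W.E1 I α ∪ W.E2 I α

/-- The Wilson Haar function `h_I^α = |E_{α,I}|^{-1/2} (1_{E²_{α,I}} - 1_{E¹_{α,I}})`. -/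
def haar (W : WilsonSystem d) (I : DyadicCube d) (α : Gamma d) : (Fin d → ℝ) → ℝ :=
  fun x => (Real.sqrt (volume (W.E I α)).toReal)⁻¹ *
    ((W.E2 I α).indicator (fun _ => (1 : ℝ)) x - (W.E1 I α).indicator (fun _ => (1 : ℝ)) x)

/-- The Haar coefficient `f̂(I,α) = ⟨f, h_I^α⟩_{L²}`. -/
def hcoef (W : WilsonSystem d) (f : (Fin d → ℝ) → ℝ) (I : DyadicCube d) (α : Gamma d) : ℝ :=
  ∫ x, f x * W.haar I α x

/-- The weighted Wilson Haar function `h_I^{w,α}`. -/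
def haarW (W : WilsonSystem d) (w : (Fin d → ℝ) → ℝ) (I : DyadicCube d) (α : Gamma d) :
    (Fin d → ℝ) → ℝ :=
  fun x => (Real.sqrt (∫ y in W.E I α, w y))⁻¹ *
    (Real.sqrt ((∫ y in W.E1 I α, w y) / (∫ y in W.E2 I α, w y)) *
        (W.E2 I α).indicator (fun _ => (1 : ℝ)) x -
      Real.sqrt ((∫ y in W.E2 I α, w y) / (∫ y in W.E1 I α, w y)) *
        (W.E1 I α).indicator (fun _ => (1 : ℝ)) x)

/-- The Haar multiplier `T_σ f = ∑_{I,α} σ_{I,α} f̂(I,α) h_I^α`. -/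
def Tmult (W : WilsonSystem d) (σ : DyadicCube d → Gamma d → ℝ) (f : (Fin d → ℝ) → ℝ) :
    (Fin d → ℝ) → ℝ :=
  fun x => ∑' p : DyadicCube d × Gamma d, σ p.1 p.2 * W.hcoef f p.1 p.2 * W.haar p.1 p.2 x

/-- The paraproduct `P_a^{(0,0)} f = ∑_{I,α} a_{I,α} f̂(I,α) h_I^α`. -/
def P00 (W : WilsonSystem d) (a : DyadicCube d → Gamma d → ℝ) (f : (Fin d → ℝ) → ℝ) :
    (Fin d → ℝ) → ℝ :=
  fun x => ∑' p : DyadicCube d × Gamma d, a p.1 p.2 * W.hcoef f p.1 p.2 * W.haar p.1 p.2 x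

/-- The paraproduct `P_a^{(0,1)} f = ∑_{I,α} a_{I,α} ⟨f⟩_{E_{α,I}} h_I^α`. -/
def P01 (W : WilsonSystem d) (a : DyadicCube d → Gamma d → ℝ) (f : (Fin d → ℝ) → ℝ) :
    (Fin d → ℝ) → ℝ :=
  fun x => ∑' p : DyadicCube d × Gamma d, a p.1 p.2 * avg (W.E p.1 p.2) f * W.haar p.1 p.2 x

/-- The paraproduct `P_a^{(1,0)} f = ∑_{I,α} a_{I,α} f̂(I,α) h¹_{E_{α,I}}`. -/
def P10 (W : WilsonSystem d) (a : DyadicCube d → Gamma d → ℝ) (f : (Fin d → ℝ) → ℝ) :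
    (Fin d → ℝ) → ℝ :=
  fun x => ∑' p : DyadicCube d × Gamma d, a p.1 p.2 * W.hcoef f p.1 p.2 * h1 (W.E p.1 p.2) x

/-- The dyadic square function
`S f(x) = (∑_{I,α} |f̂(I,α)|² 1_I(x)/|I|)^{1/2}`. -/
def sqFn (W : WilsonSystem d) (f : (Fin d → ℝ) → ℝ) : (Fin d → ℝ) → ℝ :=
  fun x => Real.sqrt (∑' p : DyadicCube d × Gamma d,
    (W.hcoef f p.1 p.2) ^ 2 * p.1.toSet.indicator (fun _ => (1 : ℝ)) x /
      (volume p.1.toSet).toReal)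

/-- The canonical paraproduct of type `ε` built from the function `g`:
`ε = 0` gives `P^{(0,1)}_{ĝ}`, `ε = 1` gives `P^{(1,0)}_{ĝ}`, and `ε = 2` gives
`P^{(0,0)}_{⟨g⟩}`. -/
def paraOf (W : WilsonSystem d) (g : (Fin d → ℝ) → ℝ) (ε : Fin 3) :
    ((Fin d → ℝ) → ℝ) → ((Fin d → ℝ) → ℝ) :=
  if ε = 0 then W.P01 (fun I α => W.hcoef g I α)
  else if ε = 1 then W.P10 (fun I α => W.hcoef g I α)
  else W.P00 (fun I α => avg (W.E I α) g)

end WilsonSystem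

/-- The weighted measure `w(x) dx` on `ℝ^d`. -/
def wMeasure {d : ℕ} (w : (Fin d → ℝ) → ℝ) : Measure (Fin d → ℝ) :=
  volume.withDensity fun x => ENNReal.ofReal (w x)

/-! ### Helper lemmas -/

lemma DyadicCube.toSet_eq_pi {d : ℕ} (I : DyadicCube d) :
    I.toSet = Set.pi Set.univ fun i =>
      Set.Ico ((I.m i : ℝ) * (2 : ℝ) ^ I.k) (((I.m i : ℝ) + 1) * (2 : ℝ) ^ I.k) := by
  ext x
  simp [DyadicCube.toSet, Set.mem_pi]

lemma DyadicCube.toSet_eq_cube {d : ℕ} (I : DyadicCube d) :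
    I.toSet = Cube (fun i => (I.m i : ℝ) * (2 : ℝ) ^ I.k) ((2 : ℝ) ^ I.k) := by
  ext x
  simp [DyadicCube.toSet, Cube, add_mul]

lemma DyadicCube.measurableSet {d : ℕ} (I : DyadicCube d) : MeasurableSet I.toSet := by
  rw [I.toSet_eq_pi]
  exact MeasurableSet.univ_pi fun i => measurableSet_Ico

lemma DyadicCube.volume_toSet {d : ℕ} (I : DyadicCube d) :
    volume I.toSet = ENNReal.ofReal ((2 : ℝ) ^ I.k) ^ d := by
  rw [I.toSet_eq_pi, Real.volume_pi_Ico]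
  simp [add_mul]

lemma DyadicCube.volume_real {d : ℕ} (I : DyadicCube d) :
    (volume I.toSet).toReal = ((2 : ℝ) ^ I.k) ^ d := by
  rw [I.volume_toSet, ENNReal.toReal_pow, ENNReal.toReal_ofReal (by positivity)]

lemma DyadicCube.volume_lt_top {d : ℕ} (I : DyadicCube d) : volume I.toSet < ⊤ := by
  rw [I.volume_toSet]
  exact ENNReal.pow_lt_top ENNReal.ofReal_lt_top

lemma DyadicCube.integrableOn {d : ℕ} (I : DyadicCube d) {f : (Fin d → ℝ) → ℝ}
    (hf : LocallyIntegrable f volume) : IntegrableOn f I.toSet volume := by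
  have hsub : I.toSet ⊆ Set.Icc (fun i => (I.m i : ℝ) * (2 : ℝ) ^ I.k)
      (fun i => ((I.m i : ℝ) + 1) * (2 : ℝ) ^ I.k) := by
    intro x hx
    exact ⟨fun i => (hx i).1, fun i => (hx i).2.le⟩
  exact (hf.integrableOn_isCompact isCompact_Icc).mono_set hsub

namespace WilsonSystem

variable {d : ℕ}

lemma measE1 (W : WilsonSystem d) (I : DyadicCube d) (α : Gamma d) :
    MeasurableSet (W.E1 I α) := by
  obtain ⟨S, -, -, h⟩ := W.childUnion1 I α
  rw [h]
  exact S.measurableSet_biUnion fun J _ => J.measurableSet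

lemma measE2 (W : WilsonSystem d) (I : DyadicCube d) (α : Gamma d) :
    MeasurableSet (W.E2 I α) := by
  obtain ⟨S, -, -, h⟩ := W.childUnion2 I α
  rw [h]
  exact S.measurableSet_biUnion fun J _ => J.measurableSet

lemma measE (W : WilsonSystem d) (I : DyadicCube d) (α : Gamma d) :
    MeasurableSet (W.E I α) := (W.measE1 I α).union (W.measE2 I α)

lemma E_subset (W : WilsonSystem d) (I : DyadicCube d) (α : Gamma d) :
    W.E I α ⊆ I.toSet := by
  obtain ⟨S, -, hS, h⟩ := W.childUnion1 I α
  obtain ⟨T, -, hT, h'⟩ := W.childUnion2 I α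
  unfold WilsonSystem.E
  rw [h, h']
  refine Set.union_subset ?_ ?_
  · exact Set.iUnion₂_subset fun J hJ => (hS J hJ).2
  · exact Set.iUnion₂_subset fun J hJ => (hT J hJ).2

lemma volE_lt_top (W : WilsonSystem d) (I : DyadicCube d) (α : Gamma d) :
    volume (W.E I α) < ⊤ := (measure_mono (W.E_subset I α)).trans_lt I.volume_lt_top

/-- `|E_{α,I}| ≥ 2^{-d} |I|`. -/
lemma volE_ge (W : WilsonSystem d) (I : DyadicCube d) (α : Gamma d) :
    (volume I.toSet).toReal ≤ 2 ^ d * (volume (W.E I α)).toReal := by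
  obtain ⟨S, ⟨J, hJ⟩, hS, h⟩ := W.childUnion1 I α
  have hsub : J.toSet ⊆ W.E I α := by
    unfold WilsonSystem.E
    rw [h]
    exact (Set.subset_biUnion_of_mem (u := fun J : DyadicCube d => J.toSet) hJ).trans
      Set.subset_union_left
  have h1 : (volume J.toSet).toReal ≤ (volume (W.E I α)).toReal :=
    ENNReal.toReal_mono (W.volE_lt_top I α).ne (measure_mono hsub)
  have hk : J.k + 1 = I.k := (hS J hJ).1
  have h2 : (volume I.toSet).toReal = 2 ^ d * (volume J.toSet).toReal := by
    rw [I.volume_real, J.volume_real, ← hk, zpow_add₀ (by norm_num), ← mul_pow]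
    congr 1
    ring
  rw [h2]
  gcongr

lemma volE_pos (W : WilsonSystem d) (I : DyadicCube d) (α : Gamma d) :
    0 < (volume (W.E I α)).toReal := by
  have h := W.volE_ge I α
  rw [I.volume_real] at h
  have : (0 : ℝ) < ((2 : ℝ) ^ I.k) ^ d := by positivity
  by_contra hc
  have h0 : (volume (W.E I α)).toReal ≤ 0 := not_lt.mp hc
  have : 2 ^ d * (volume (W.E I α)).toReal ≤ 0 :=
    mul_nonpos_of_nonneg_of_nonpos (by positivity) h0
  linarith

lemma memLp_haar (W : WilsonSystem d) (I : DyadicCube d) (α : Gamma d) :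
    MemLp (W.haar I α) 2 volume := by
  have hf1 : volume (W.E1 I α) ≠ ⊤ :=
    ((measure_mono Set.subset_union_left).trans_lt (W.volE_lt_top I α)).ne
  have hf2 : volume (W.E2 I α) ≠ ⊤ :=
    ((measure_mono Set.subset_union_right).trans_lt (W.volE_lt_top I α)).ne
  exact ((memLp_indicator_const 2 (W.measE2 I α) (1 : ℝ) (Or.inr hf2)).sub
    (memLp_indicator_const 2 (W.measE1 I α) (1 : ℝ) (Or.inr hf1))).const_mul _

lemma haar_eq_zero (W : WilsonSystem d) (I : DyadicCube d) (α : Gamma d) {x : Fin d → ℝ}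
    (hx : x ∉ W.E I α) : W.haar I α x = 0 := by
  have h1 : x ∉ W.E1 I α := fun h => hx (Or.inl h)
  have h2 : x ∉ W.E2 I α := fun h => hx (Or.inr h)
  simp [WilsonSystem.haar, h1, h2]

lemma integral_haar (W : WilsonSystem d) (I : DyadicCube d) (α : Gamma d) :
    ∫ x, W.haar I α x = 0 := by
  have hf1 : volume (W.E1 I α) ≠ ⊤ :=
    ((measure_mono Set.subset_union_left).trans_lt (W.volE_lt_top I α)).ne
  have hf2 : volume (W.E2 I α) ≠ ⊤ :=
    ((measure_mono Set.subset_union_right).trans_lt (W.volE_lt_top I α)).ne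
  unfold WilsonSystem.haar
  rw [integral_const_mul, integral_sub]
  · rw [integral_indicator_const _ (W.measE1 I α), integral_indicator_const _ (W.measE2 I α)]
    simp [Measure.real, W.measEq I α]
  · exact (integrable_indicator_iff (W.measE2 I α)).2 (integrableOn_const hf2)
  · exact (integrable_indicator_iff (W.measE1 I α)).2 (integrableOn_const hf1)

lemma haar_sq (W : WilsonSystem d) (I : DyadicCube d) (α : Gamma d) (x : Fin d → ℝ) :
    W.haar I α x * W.haar I α x =
      (W.E I α).indicator (fun _ => ((volume (W.E I α)).toReal)⁻¹) x := by
  have hs : (Real.sqrt (volume (W.E I α)).toReal)⁻¹ * (Real.sqrt (volume (W.E I α)).toReal)⁻¹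
      = ((volume (W.E I α)).toReal)⁻¹ := by
    rw [← mul_inv, Real.mul_self_sqrt ENNReal.toReal_nonneg]
  by_cases h1 : x ∈ W.E1 I α
  · have h2 : x ∉ W.E2 I α := Set.disjoint_left.1 (W.disj I α) h1
    have hE : x ∈ W.E I α := Or.inl h1
    rw [Set.indicator_of_mem hE, ← hs]
    simp [WilsonSystem.haar, h1, h2]
  · by_cases h2 : x ∈ W.E2 I α
    · have hE : x ∈ W.E I α := Or.inr h2
      rw [Set.indicator_of_mem hE, ← hs]
      simp [WilsonSystem.haar, h1, h2]
    · have hE : x ∉ W.E I α := fun h => h.elim h1 h2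
      rw [Set.indicator_of_notMem hE, W.haar_eq_zero I α hE, mul_zero]

lemma integral_haar_sq (W : WilsonSystem d) (I : DyadicCube d) (α : Gamma d) :
    ∫ x, W.haar I α x * W.haar I α x = 1 := by
  simp_rw [W.haar_sq I α]
  rw [integral_indicator_const _ (W.measE I α), Measure.real, smul_eq_mul,
    mul_inv_cancel₀ (W.volE_pos I α).ne']

/-- If `h_J^β` is constant on `E_{α,I}`, then `h_I^α ⟂ h_J^β`. -/
lemma integral_haar_mul_of_const (W : WilsonSystem d) (I : DyadicCube d) (α : Gamma d)
    (g : (Fin d → ℝ) → ℝ) (c : ℝ) (hc : ∀ x ∈ W.E I α, g x = c) :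
    ∫ x, W.haar I α x * g x = 0 := by
  have : (fun x => W.haar I α x * g x) = fun x => W.haar I α x * c := by
    funext x
    by_cases hx : x ∈ W.E I α
    · rw [hc x hx]
    · rw [W.haar_eq_zero I α hx, zero_mul, zero_mul]
  rw [this, integral_mul_const, W.integral_haar, zero_mul]

lemma haar_const_E1 (W : WilsonSystem d) (J : DyadicCube d) (β : Gamma d) {x : Fin d → ℝ}
    (h1 : x ∈ W.E1 J β) : W.haar J β x = -(Real.sqrt (volume (W.E J β)).toReal)⁻¹ := by
  have h2 : x ∉ W.E2 J β := Set.disjoint_left.1 (W.disj J β) h1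
  simp [WilsonSystem.haar, h1, h2]

lemma haar_const_E2 (W : WilsonSystem d) (J : DyadicCube d) (β : Gamma d) {x : Fin d → ℝ}
    (h2 : x ∈ W.E2 J β) : W.haar J β x = (Real.sqrt (volume (W.E J β)).toReal)⁻¹ := by
  have h1 : x ∉ W.E1 J β := Set.disjoint_right.1 (W.disj J β) h2
  simp [WilsonSystem.haar, h1, h2]

lemma integral_haar_mul (W : WilsonSystem d) (p q : DyadicCube d × Gamma d) (hpq : p ≠ q) :
    ∫ x, W.haar p.1 p.2 x * W.haar q.1 q.2 x = 0 := by
  rcases W.nestedOrDisjoint p.1 p.2 q.1 q.2 hpq with h | h | h | h | h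
  · exact W.integral_haar_mul_of_const _ _ _ _ fun x hx => W.haar_const_E1 _ _ (h hx)
  · exact W.integral_haar_mul_of_const _ _ _ _ fun x hx => W.haar_const_E2 _ _ (h hx)
  · simp_rw [mul_comm (W.haar p.1 p.2 _)]
    exact W.integral_haar_mul_of_const _ _ _ _ fun x hx => W.haar_const_E1 _ _ (h hx)
  · simp_rw [mul_comm (W.haar p.1 p.2 _)]
    exact W.integral_haar_mul_of_const _ _ _ _ fun x hx => W.haar_const_E2 _ _ (h hx)
  · exact W.integral_haar_mul_of_const _ _ _ 0 fun x hx =>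
      W.haar_eq_zero _ _ (Set.disjoint_left.1 h hx)

lemma inner_toLp {f g : (Fin d → ℝ) → ℝ} (hf : MemLp f 2 volume) (hg : MemLp g 2 volume) :
    inner ℝ (hf.toLp f) (hg.toLp g) = ∫ x, f x * g x := by
  rw [L2.inner_def]
  refine integral_congr_ae ?_
  filter_upwards [hf.coeFn_toLp, hg.coeFn_toLp] with x h1 h2
  rw [h1, h2]
  simp [mul_comm]

lemma orthonormal_haar (W : WilsonSystem d) :
    Orthonormal ℝ fun p : DyadicCube d × Gamma d =>
      (W.memLp_haar p.1 p.2).toLp (W.haar p.1 p.2) := by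
  classical
  rw [orthonormal_iff_ite]
  intro p q
  rw [inner_toLp]
  split_ifs with h
  · subst h
    exact W.integral_haar_sq _ _
  · exact W.integral_haar_mul p q h

/-- Bessel's inequality localized to `E_{α,I}`. -/
lemma bessel (W : WilsonSystem d) (I : DyadicCube d) (α : Gamma d)
    (f : (Fin d → ℝ) → ℝ) (hf : Measurable f)
    (hint : IntegrableOn (fun x => f x ^ 2) (W.E I α) volume)
    (F : Finset (DyadicCube d × Gamma d)) (hF : ∀ p ∈ F, W.E p.1 p.2 ⊆ W.E I α) :
    ∑ p ∈ F, (W.hcoef f p.1 p.2) ^ 2 ≤ ∫ x in W.E I α, f x ^ 2 := by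
  set g : (Fin d → ℝ) → ℝ := (W.E I α).indicator f with hg
  have hgm : Measurable g := hf.indicator (W.measE I α)
  have hg2 : (fun x => g x ^ 2) = (W.E I α).indicator fun x => f x ^ 2 := by
    funext x
    by_cases hx : x ∈ W.E I α <;> simp [hg, hx]
  have hgL : MemLp g 2 volume := by
    rw [memLp_two_iff_integrable_sq hgm.aestronglyMeasurable, hg2]
    exact (integrable_indicator_iff (W.measE I α)).2 hint
  have hb := W.orthonormal_haar.sum_inner_products_le (hgL.toLp g) (s := F)
  have hn : ‖hgL.toLp g‖ ^ 2 = ∫ x in W.E I α, f x ^ 2 := by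
    rw [← real_inner_self_eq_norm_sq, inner_toLp, ← integral_indicator (W.measE I α), ← hg2]
    simp_rw [sq]
  rw [hn] at hb
  refine le_trans (le_of_eq (Finset.sum_congr rfl fun p hp => ?_)) hb
  rw [inner_toLp, Real.norm_eq_abs, sq_abs]
  congr 1
  unfold WilsonSystem.hcoef
  congr 1
  funext x
  by_cases hx : x ∈ W.E p.1 p.2
  · rw [hg, Set.indicator_of_mem (hF p hp hx), mul_comm]
  · rw [W.haar_eq_zero _ _ hx, mul_zero, zero_mul]

lemma avg_E_le (W : WilsonSystem d) (I : DyadicCube d) (α : Gamma d)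
    (f : (Fin d → ℝ) → ℝ) (hf : ∀ x, 0 < f x) (hloc : LocallyIntegrable f volume) :
    avg (W.E I α) f ≤ 2 ^ d * avg I.toSet f := by
  unfold avg
  have hE := W.volE_pos I α
  have hIpos : 0 < (volume I.toSet).toReal := by
    rw [I.volume_real]; positivity
  have hle : ∫ x in W.E I α, f x ≤ ∫ x in I.toSet, f x :=
    setIntegral_mono_set (I.integrableOn hloc) (Filter.Eventually.of_forall fun x => (hf x).le)
      (Filter.Eventually.of_forall (W.E_subset I α))
  have h0 : 0 ≤ ∫ x in I.toSet, f x := integral_nonneg fun x => (hf x).le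
  rw [← mul_div_assoc, div_le_div_iff₀ hE hIpos]
  calc (∫ x in W.E I α, f x) * (volume I.toSet).toReal
      ≤ (∫ x in I.toSet, f x) * (2 ^ d * (volume (W.E I α)).toReal) :=
        mul_le_mul hle (W.volE_ge I α) hIpos.le h0
    _ = _ := by ring

lemma avg_nonneg {E : Set (Fin d → ℝ)} {f : (Fin d → ℝ) → ℝ} (hf : ∀ x, 0 < f x) :
    0 ≤ avg E f :=
  div_nonneg (integral_nonneg fun x => (hf x).le) ENNReal.toReal_nonneg

end WilsonSystem

/-- Cauchy–Schwarz/Bessel estimate: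
`|E_{α,I}|⁻¹ ∑_{J⊆I, E_{β,J}⊆E_{α,I}} |ŵ^{1/2}(J,β) ŵ^{-1/2}(J,β)|
  ≤ (⟨w⟩_{E_{α,I}} ⟨w⁻¹⟩_{E_{α,I}})^{1/2} ≤ C_d [w]^{1/2}_{A₂}`. -/
theorem carleson_estimate_whalf_whalfinv (d : ℕ) :
    ∃ C : ℝ, 0 < C ∧
      ∀ (W : WilsonSystem d) (w : (Fin d → ℝ) → ℝ) (A : ℝ),
        IsWeight w → IsA2Bound w A →
        ∀ (I : DyadicCube d) (α : Gamma d),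
          (∀ F : Finset (DyadicCube d × Gamma d),
            (∀ p ∈ F, p.1.toSet ⊆ I.toSet ∧ W.E p.1 p.2 ⊆ W.E I α) →
            ((volume (W.E I α)).toReal)⁻¹ *
                ∑ p ∈ F,
                  |W.hcoef (fun x => Real.sqrt (w x)) p.1 p.2 *
                    W.hcoef (fun x => (Real.sqrt (w x))⁻¹) p.1 p.2| ≤
              Real.sqrt
                (avg (W.E I α) w * avg (W.E I α) fun x => (w x)⁻¹)) ∧
          Real.sqrt (avg (W.E I α) w * avg (W.E I α) fun x => (w x)⁻¹) ≤
            C * Real.sqrt A := by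
  refine ⟨2 ^ d, by positivity, ?_⟩
  intro W w A hw hA I α
  obtain ⟨hpos, hmeas, hloc, hloc'⟩ := hw
  have hpos' : ∀ x, 0 < (w x)⁻¹ := fun x => inv_pos.2 (hpos x)
  refine ⟨?_, ?_⟩
  · intro F hF
    have hF' : ∀ p ∈ F, W.E p.1 p.2 ⊆ W.E I α := fun p hp => (hF p hp).2
    have hV := W.volE_pos I α
    have e1 : (fun x => Real.sqrt (w x) ^ 2) = w := by
      funext x
      exact Real.sq_sqrt (hpos x).le
    have e2 : (fun x => (Real.sqrt (w x))⁻¹ ^ 2) = fun x => (w x)⁻¹ := by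
      funext x
      rw [inv_pow, Real.sq_sqrt (hpos x).le]
    have b1 := W.bessel I α (fun x => Real.sqrt (w x)) hmeas.sqrt
      (by rw [e1]; exact (I.integrableOn hloc).mono_set (W.E_subset I α)) F hF'
    have b2 := W.bessel I α (fun x => (Real.sqrt (w x))⁻¹) hmeas.sqrt.inv
      (by rw [e2]; exact (I.integrableOn hloc').mono_set (W.E_subset I α)) F hF'
    rw [e1] at b1
    rw [e2] at b2
    have hcs := Finset.sum_mul_sq_le_sq_mul_sq F
      (fun p => |W.hcoef (fun x => Real.sqrt (w x)) p.1 p.2|)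
      (fun p => |W.hcoef (fun x => (Real.sqrt (w x))⁻¹) p.1 p.2|)
    simp only [sq_abs, ← abs_mul] at hcs
    apply Real.le_sqrt_of_sq_le
    unfold avg
    rw [mul_pow, div_mul_div_comm, inv_pow, inv_mul_eq_div, ← sq]
    gcongr
    exact hcs.trans (mul_le_mul b1 b2 (Finset.sum_nonneg fun p _ => sq_nonneg _)
      (integral_nonneg fun x => (hpos x).le))
  · have h1 := W.avg_E_le I α w hpos hloc
    have h2 := W.avg_E_le I α (fun x => (w x)⁻¹) hpos' hloc'
    have h3 := hA (fun i => (I.m i : ℝ) * (2 : ℝ) ^ I.k) ((2 : ℝ) ^ I.k) (by positivity)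
    rw [← I.toSet_eq_cube] at h3
    have h4 : avg (W.E I α) w * avg (W.E I α) (fun x => (w x)⁻¹) ≤ (2 ^ d) ^ 2 * A := by
      calc _ ≤ (2 ^ d * avg I.toSet w) * (2 ^ d * avg I.toSet fun x => (w x)⁻¹) :=
            mul_le_mul h1 h2 (WilsonSystem.avg_nonneg hpos')
              (mul_nonneg (by positivity) (WilsonSystem.avg_nonneg hpos))
        _ = (2 ^ d) ^ 2 * (avg I.toSet w * avg I.toSet fun x => (w x)⁻¹) := by ring
        _ ≤ _ := by gcongr
    calc _ ≤ Real.sqrt ((2 ^ d) ^ 2 * A) := Real.sqrt_le_sqrt h4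
      _ = _ := by rw [Real.sqrt_mul (by positivity), Real.sqrt_sq (by positivity)]
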